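/- arXiv:2602.18718 — 3 statements merged into one kernel-verified Lean document; each statement's English description precedes it below -/
import Mathlib

section
/- Price's theorem (first equality of Proposition 2.1): Let d ≥ 1, let Σ be a d×d real symmetric positive-definite matrix, m ∈ ℝ^d, and let H be a d×d real symmetric matrix. Let f : ℝ^d → ℝ be twice continuously differentiable such that f, its gradient ∇f, and its Hessian ∇²f all have at most polynomial growth (there exist a > 0 and n ∈ ℕ with |f(x)|, ‖∇f(x)‖, ‖∇²f(x)‖ ≤ a(1+‖x‖)^n for all x). Then the map t ↦ ∫ f dN(m, Σ + tH), defined for all real t small enough that Σ + tH is positive definite, is differentiable at t = 0 with derivative equal to (1/2)·∫ tr(∇²f(x) H) dN(m,Σ)(x); that is, the derivative of the expected value of f with respect to the covariance parameter Σ in direction H equals (1/2)⟨∫ ∇²f dN(m,Σ), H⟩_F, where ⟨A,B⟩_F = tr(AᵀB). -/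
open MeasureTheory Matrix Real
open scoped RealInnerProductSpace

noncomputable section

/-- `ℝ^d` as a Euclidean space. -/
abbrev Vec (d : ℕ) := EuclideanSpace ℝ (Fin d)

/-- `d × d` real matrices. -/
abbrev Mat (d : ℕ) := Matrix (Fin d) (Fin d) ℝ

variable {d : ℕ}

/-- Matrix-vector product as a map on Euclidean space. -/
def matVec (A : Mat d) (x : Vec d) : Vec d :=
  (EuclideanSpace.equiv (Fin d) ℝ).symm (A.mulVec (EuclideanSpace.equiv (Fin d) ℝ x))

/-- The Gaussian measure `N(m, S)` on `ℝ^d` with mean `m` and covariance `S`,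
defined via its density with respect to Lebesgue measure.  (For `S` positive
definite this is the usual Gaussian probability measure.) -/
def gaussian (m : Vec d) (S : Mat d) : Measure (Vec d) :=
  volume.withDensity fun x =>
    ENNReal.ofReal (Real.sqrt (((2 * π) ^ d * S.det)⁻¹) *
      Real.exp (-⟪x - m, matVec S⁻¹ (x - m)⟫ / 2))

/-- The Hessian of `f : ℝ^d → ℝ` at `x`, as a `d × d` matrix. -/
def hess (f : Vec d → ℝ) (x : Vec d) : Mat d :=
  Matrix.of fun i j =>
    fderiv ℝ (fun y => fderiv ℝ f y (EuclideanSpace.single j 1)) x (EuclideanSpace.single i 1)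

/-- Frobenius norm of a matrix. -/
def frobNorm (A : Mat d) : ℝ := Real.sqrt (∑ i, ∑ j, (A i j) ^ 2)

/-- Squared Frobenius norm of a matrix. -/
def frobSq (A : Mat d) : ℝ := ∑ i, ∑ j, (A i j) ^ 2

/-- Jacobian of `g : ℝ^d → ℝ^d` at `x`: `(jacobian g x) i j = ∂ g_j / ∂ x_i`. -/
def jacobian (g : Vec d → Vec d) (x : Vec d) : Mat d :=
  Matrix.of fun i j => fderiv ℝ (fun y => g y j) x (EuclideanSpace.single i 1)

/-- At most polynomial growth. -/
def PolyGrowth (g : Vec d → ℝ) : Prop :=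
  ∃ (a : ℝ) (n : ℕ), 0 ≤ a ∧ ∀ x, |g x| ≤ a * (1 + ‖x‖) ^ n

/-- The unnormalised standard Gaussian density. -/
def gaussWeight (z : Vec d) : ℝ := Real.exp (-‖z‖ ^ 2 / 2)

namespace PolyGrowth

lemma const (c : ℝ) : PolyGrowth (fun _ : Vec d => c) := ⟨|c|, 0, abs_nonneg c, by simp⟩

lemma norm : PolyGrowth (fun x : Vec d => ‖x‖) := ⟨1, 1, zero_le_one, fun x => by simp⟩

lemma coord (i : Fin d) : PolyGrowth (fun x : Vec d => x i) :=
  ⟨1, 1, zero_le_one, fun x => by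
    have := PiLp.norm_apply_le x i
    rw [Real.norm_eq_abs] at this
    linarith⟩

lemma add {g h : Vec d → ℝ} (hg : PolyGrowth g) (hh : PolyGrowth h) :
    PolyGrowth (fun x => g x + h x) := by
  obtain ⟨a, n, ha, hg⟩ := hg
  obtain ⟨b, k, hb, hh⟩ := hh
  refine ⟨a + b, n + k, by positivity, fun x => ?_⟩
  have h1 : 1 ≤ 1 + ‖x‖ := by linarith [norm_nonneg x]
  have e1 : (1 + ‖x‖) ^ n ≤ (1 + ‖x‖) ^ (n + k) := pow_le_pow_right₀ h1 (by omega)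
  have e2 : (1 + ‖x‖) ^ k ≤ (1 + ‖x‖) ^ (n + k) := pow_le_pow_right₀ h1 (by omega)
  calc |g x + h x| ≤ |g x| + |h x| := abs_add_le _ _
    _ ≤ a * (1 + ‖x‖) ^ n + b * (1 + ‖x‖) ^ k := add_le_add (hg x) (hh x)
    _ ≤ a * (1 + ‖x‖) ^ (n + k) + b * (1 + ‖x‖) ^ (n + k) := by gcongr
    _ = _ := by ring

lemma mul {g h : Vec d → ℝ} (hg : PolyGrowth g) (hh : PolyGrowth h) :
    PolyGrowth (fun x => g x * h x) := by
  obtain ⟨a, n, ha, hg⟩ := hg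
  obtain ⟨b, k, hb, hh⟩ := hh
  refine ⟨a * b, n + k, by positivity, fun x => ?_⟩
  calc |g x * h x| = |g x| * |h x| := abs_mul _ _
    _ ≤ (a * (1 + ‖x‖) ^ n) * (b * (1 + ‖x‖) ^ k) := by
      gcongr
      exacts [hg x, hh x]
    _ = _ := by ring

lemma sum {ι : Type*} (s : Finset ι) {g : ι → Vec d → ℝ} (hg : ∀ i ∈ s, PolyGrowth (g i)) :
    PolyGrowth (fun x => ∑ i ∈ s, g i x) := by
  classical
  induction s using Finset.induction_on with
  | empty => simpa using const 0
  | insert i s hi ih =>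
    simp only [Finset.sum_insert hi]
    exact (hg i (by simp)).add (ih fun j hj => hg j (by simp [hj]))

lemma mono {g h : Vec d → ℝ} (hg : PolyGrowth g) (hh : ∀ x, |h x| ≤ |g x|) : PolyGrowth h := by
  obtain ⟨a, n, ha, hg⟩ := hg
  exact ⟨a, n, ha, fun x => (hh x).trans (hg x)⟩

lemma pow {g : Vec d → ℝ} (hg : PolyGrowth g) (n : ℕ) : PolyGrowth (fun x => g x ^ n) := by
  induction n with
  | zero => simpa using const 1
  | succ n ih => simpa only [pow_succ] using ih.mul hg

lemma comp {g : Vec d → ℝ} (hg : PolyGrowth g) {T : Vec d → Vec d}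
    (hT : PolyGrowth (fun x => ‖T x‖)) : PolyGrowth (fun x => g (T x)) := by
  obtain ⟨a, n, ha, hg⟩ := hg
  refine mono ((const a).mul (((const 1).add hT).pow n)) fun x => ?_
  rw [abs_of_nonneg (by positivity : 0 ≤ a * (1 + ‖T x‖) ^ n)]
  exact hg (T x)

end PolyGrowth

lemma contDiff_gaussWeight : ContDiff ℝ 1 (gaussWeight : Vec d → ℝ) := by
  exact ((contDiff_norm_sq ℝ).neg.div_const 2).exp

lemma gaussWeight_pos (z : Vec d) : 0 < gaussWeight z := Real.exp_pos _

lemma fderiv_gaussWeight (z v : Vec d) :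
    fderiv ℝ gaussWeight z v = -(⟪z, v⟫ * gaussWeight z) := by
  have h : HasFDerivAt (gaussWeight : Vec d → ℝ) _ z :=
    (((hasStrictFDerivAt_norm_sq z).hasFDerivAt.neg.mul_const (2⁻¹ : ℝ)).exp)
  rw [h.fderiv]
  simp [gaussWeight, div_eq_mul_inv]
  ring

lemma integrable_gaussWeight_mul {g : Vec d → ℝ} (hg : PolyGrowth g) (hc : Continuous g) :
    Integrable (fun z => gaussWeight z * g z) := by
  obtain ⟨a, n, ha, hg⟩ := hg
  have hexp : Integrable (fun z : Vec d => Real.exp (-(1 / 4) * ‖z‖ ^ 2)) := by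
    have := (GaussianFourier.integrable_cexp_neg_mul_sq_norm_add (V := Vec d)
      (b := (1 / 4 : ℝ)) (by norm_num) 0 0).re
    refine this.congr (.of_forall fun z => ?_)
    simp only [zero_mul, add_zero]
    rw [← Complex.ofReal_pow, ← Complex.ofReal_neg, ← Complex.ofReal_mul]
    exact Complex.exp_ofReal_re _
  have hbound : ∃ C, ∀ r : ℝ, 0 ≤ r → (1 + r) ^ n * Real.exp (-r ^ 2 / 4) ≤ C := by
    refine ⟨n.factorial * Real.exp 2, fun r hr => ?_⟩
    have h1 : (1 + r) ^ n ≤ n.factorial * Real.exp (1 + r) := by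
      have := Real.pow_div_factorial_le_exp (1 + r) (by positivity) n
      rwa [div_le_iff₀' (by positivity)] at this
    calc (1 + r) ^ n * Real.exp (-r ^ 2 / 4)
        ≤ (n.factorial * Real.exp (1 + r)) * Real.exp (-r ^ 2 / 4) := by gcongr
      _ = n.factorial * Real.exp (1 + r + -r ^ 2 / 4) := by rw [Real.exp_add (1 + r)]; ring
      _ ≤ n.factorial * Real.exp 2 := by
        gcongr
        nlinarith [sq_nonneg (r - 2)]
  obtain ⟨C, hC⟩ := hbound
  refine (hexp.const_mul (a * C)).mono'
    (contDiff_gaussWeight.continuous.mul hc).aestronglyMeasurable (.of_forall fun z => ?_)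
  rw [Real.norm_eq_abs, abs_mul, abs_of_pos (gaussWeight_pos z)]
  have hsplit : gaussWeight z = Real.exp (-‖z‖ ^ 2 / 4) * Real.exp (-(1 / 4) * ‖z‖ ^ 2) := by
    rw [gaussWeight, ← Real.exp_add]
    ring_nf
  calc gaussWeight z * |g z| ≤ gaussWeight z * (a * (1 + ‖z‖) ^ n) :=
        mul_le_mul_of_nonneg_left (hg z) (gaussWeight_pos z).le
    _ = a * ((1 + ‖z‖) ^ n * Real.exp (-‖z‖ ^ 2 / 4)) * Real.exp (-(1 / 4) * ‖z‖ ^ 2) := by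
      rw [hsplit]; ring
    _ ≤ a * C * Real.exp (-(1 / 4) * ‖z‖ ^ 2) := by
      gcongr
      exact hC _ (norm_nonneg z)

/-- Stein's identity for the unnormalised standard Gaussian density. -/
lemma integral_gaussWeight_coord_mul {g : Vec d → ℝ} (hg : ContDiff ℝ 1 g) (hg0 : PolyGrowth g)
    (i : Fin d) (hg1 : PolyGrowth (fun z => fderiv ℝ g z (EuclideanSpace.single i 1))) :
    ∫ z, gaussWeight z * (z i * g z) =
      ∫ z, gaussWeight z * fderiv ℝ g z (EuclideanSpace.single i 1) := by
  have hcoord : Continuous fun z : Vec d => z i := by fun_prop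
  have hw (z : Vec d) : g z * fderiv ℝ gaussWeight z (EuclideanSpace.single i 1) =
      -(gaussWeight z * (z i * g z)) := by
    rw [fderiv_gaussWeight, real_inner_comm, EuclideanSpace.inner_single_left]
    simp
    ring
  have key := integral_mul_fderiv_eq_neg_fderiv_mul_of_integrable (μ := volume)
    (f := g) (g := gaussWeight) (v := EuclideanSpace.single i 1) ?_ ?_ ?_
    (fun z _ => hg.differentiable one_ne_zero z)
    (fun z _ => contDiff_gaussWeight.differentiable one_ne_zero z)
  · simp only [hw, integral_neg, neg_inj] at key
    simpa only [mul_comm] using key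
  · simpa only [mul_comm] using integrable_gaussWeight_mul hg1
      ((hg.continuous_fderiv one_ne_zero).clm_apply continuous_const)
  · simp only [hw]
    exact (integrable_gaussWeight_mul ((PolyGrowth.coord i).mul hg0)
      (hcoord.mul hg.continuous)).neg
  · simpa only [mul_comm] using integrable_gaussWeight_mul hg0 hg.continuous

lemma matVec_eq_toEuclideanCLM (A : Mat d) (x : Vec d) :
    matVec A x = toEuclideanCLM (𝕜 := ℝ) A x := rfl

lemma toEuclideanCLM_eq_sum (A : Mat d) (x : Vec d) :
    toEuclideanCLM (𝕜 := ℝ) A x = ∑ i, x i • WithLp.toLp 2 (A.col i) := by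
  ext j
  simp [Matrix.mulVec, dotProduct, mul_comm]

lemma inner_matVec_inv_mul_transpose {B : Mat d} (hB : B.det ≠ 0) (z : Vec d) :
    ⟪toEuclideanCLM (𝕜 := ℝ) B z, matVec (B * Bᵀ)⁻¹ (toEuclideanCLM (𝕜 := ℝ) B z)⟫ =
      ‖z‖ ^ 2 := by
  have hu : IsUnit B.det := hB.isUnit
  have hut : IsUnit Bᵀ.det := by rwa [det_transpose]
  have h : Bᵀ * ((B * Bᵀ)⁻¹ * B) = 1 := by
    rw [Matrix.mul_inv_rev, Matrix.mul_assoc, Matrix.nonsing_inv_mul _ hu, Matrix.mul_one,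
      Matrix.mul_nonsing_inv _ hut]
  rw [matVec_eq_toEuclideanCLM, inner_toEuclideanCLM, ofLp_toEuclideanCLM, mulVec_mulVec,
    ← vecMul_transpose, ← dotProduct_mulVec, mulVec_mulVec, h, one_mulVec,
    ← real_inner_self_eq_norm_sq]
  rfl

/-- A Gaussian integral with covariance `B Bᵀ` as an integral against the standard weight. -/
lemma integral_gaussian_mul_transpose (m : Vec d) {B : Mat d} (hB : B.det ≠ 0) (f : Vec d → ℝ) :
    ∫ x, f x ∂(gaussian m (B * Bᵀ)) =
      √((2 * π) ^ d)⁻¹ * ∫ z, gaussWeight z * f (m + toEuclideanCLM (𝕜 := ℝ) B z) := by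
  have hmeas : Measurable fun x : Vec d => ENNReal.ofReal (√(((2 * π) ^ d * (B * Bᵀ).det)⁻¹) *
      Real.exp (-⟪x - m, matVec (B * Bᵀ)⁻¹ (x - m)⟫ / 2)) := by
    simp only [matVec_eq_toEuclideanCLM]
    fun_prop
  rw [gaussian, integral_withDensity_eq_integral_toReal_smul hmeas
    (.of_forall fun _ => ENNReal.ofReal_lt_top), ← integral_add_left_eq_self _ m]
  have hdet : LinearMap.det (toEuclideanCLM (𝕜 := ℝ) B : Vec d →ₗ[ℝ] Vec d) = B.det := by
    rw [coe_toEuclideanCLM_eq_toEuclideanLin, Matrix.toEuclideanLin, Matrix.toLpLin_eq_toLin,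
      LinearMap.det_toLin]
  have hmap := Measure.map_linearMap_addHaar_eq_smul_addHaar (volume : Measure (Vec d))
    (f := (toEuclideanCLM (𝕜 := ℝ) B : Vec d →ₗ[ℝ] Vec d)) (by rwa [hdet])
  rw [hdet] at hmap
  have hemb : MeasurableEmbedding (toEuclideanCLM (𝕜 := ℝ) B : Vec d →ₗ[ℝ] Vec d) :=
    (LinearEquiv.toContinuousLinearEquiv (LinearMap.equivOfDetNeZero
      (toEuclideanCLM (𝕜 := ℝ) B : Vec d →ₗ[ℝ] Vec d)
      (by rwa [hdet]))).toHomeomorph.measurableEmbedding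
  have hcv (F : Vec d → ℝ) :
      ∫ y, F y = |B.det| * ∫ z, F (toEuclideanCLM (𝕜 := ℝ) B z) := by
    have := hemb.integral_map (μ := volume) F
    rw [hmap, integral_smul_measure, ENNReal.toReal_ofReal (abs_nonneg _), abs_inv,
      smul_eq_mul] at this
    rw [← ContinuousLinearMap.coe_coe, ← this, mul_inv_cancel_left₀ (abs_ne_zero.mpr hB)]
  rw [hcv, ← integral_const_mul, ← integral_const_mul]
  congr 1 with z
  rw [add_sub_cancel_left, inner_matVec_inv_mul_transpose hB,
    ENNReal.toReal_ofReal (by positivity), det_mul, det_transpose, mul_inv,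
    Real.sqrt_mul (by positivity), Real.sqrt_inv (B.det * B.det), Real.sqrt_mul_self_eq_abs,
    smul_eq_mul, gaussWeight]
  have := abs_ne_zero.mpr hB
  field_simp

open scoped MatrixOrder in
/-- A positive definite and a symmetric matrix are simultaneously diagonalised by congruence. -/
lemma exists_congr_diagonal {S H : Mat d} (hS : S.PosDef) (hH : H.IsSymm) :
    ∃ (P : Mat d) (D : Fin d → ℝ), P.det ≠ 0 ∧ P * Pᵀ = S ∧ P * diagonal D * Pᵀ = H := by
  obtain ⟨B, hB⟩ : ∃ B : Mat d, S = B * Bᵀ := by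
    obtain ⟨B, hB⟩ := CStarAlgebra.nonneg_iff_eq_mul_star_self.mp hS.posSemidef.nonneg
    exact ⟨B, by rw [hB, star_eq_conjTranspose, conjTranspose_eq_transpose_of_trivial]⟩
  have hBdet : B.det ≠ 0 := fun h => hS.det_pos.ne' (by rw [hB, det_mul, h, zero_mul])
  have hBu : IsUnit B.det := hBdet.isUnit
  have hM : (B⁻¹ * H * B⁻¹ᵀ).IsHermitian := by
    rw [IsHermitian, conjTranspose_eq_transpose_of_trivial]
    simp [Matrix.transpose_mul, hH.eq, Matrix.mul_assoc]
  let U : Mat d := hM.eigenvectorUnitary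
  have hUU : U * Uᵀ = 1 := by
    simpa [star_eq_conjTranspose, conjTranspose_eq_transpose_of_trivial] using
      Unitary.mul_star_self_of_mem hM.eigenvectorUnitary.2
  have hspec : B⁻¹ * H * B⁻¹ᵀ = U * diagonal hM.eigenvalues * Uᵀ := by
    have := hM.spectral_theorem
    rw [Unitary.conjStarAlgAut_apply] at this
    simpa [star_eq_conjTranspose, conjTranspose_eq_transpose_of_trivial] using this
  refine ⟨B * U, hM.eigenvalues, ?_, ?_, ?_⟩
  · rw [det_mul]
    refine mul_ne_zero hBdet fun h => ?_
    simpa [h] using congrArg det hUU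
  · rw [hB, transpose_mul, Matrix.mul_assoc, ← Matrix.mul_assoc U, hUU, Matrix.one_mul]
  · calc B * U * diagonal hM.eigenvalues * (B * U)ᵀ
        = B * (U * diagonal hM.eigenvalues * Uᵀ) * Bᵀ := by
          simp only [transpose_mul, Matrix.mul_assoc]
      _ = (B * B⁻¹) * H * (B * B⁻¹)ᵀ := by
          rw [← hspec]
          simp only [transpose_mul, Matrix.mul_assoc]
      _ = H := by rw [Matrix.mul_nonsing_inv _ hBu]; simp

/-- Differentiation under the integral along the scaled coordinates. -/
lemma hasDerivAt_integral_gaussWeight_sqrt (m : Vec d) (p : Fin d → Vec d) (D : Fin d → ℝ)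
    {f : Vec d → ℝ} (hf : ContDiff ℝ 1 f) (hf0 : PolyGrowth f)
    (hf1 : PolyGrowth fun x => ‖fderiv ℝ f x‖) :
    HasDerivAt (fun t : ℝ => ∫ z, gaussWeight z * f (m + ∑ i, (√(1 + t * D i) * z i) • p i))
      (∫ z, gaussWeight z *
        fderiv ℝ f (m + ∑ i, z i • p i) (∑ i, (D i / 2 * z i) • p i)) 0 := by
  let X : ℝ → Vec d → Vec d := fun t z => m + ∑ i, (√(1 + t * D i) * z i) • p i
  let X' : ℝ → Vec d → Vec d := fun t z => ∑ i, (D i / (2 * √(1 + t * D i)) * z i) • p i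
  have hcoord (z : Vec d) (i : Fin d) : |z i| ≤ ‖z‖ := PiLp.norm_apply_le z i
  have hXc (t : ℝ) : Continuous (X t) := by fun_prop
  have hX'c (t : ℝ) : Continuous (X' t) := by fun_prop
  let R : Vec d → ℝ := fun z => ‖m‖ + ∑ i, 2 * ‖z‖ * ‖p i‖
  let Q : Vec d → ℝ := fun z => ∑ i, |D i| * ‖z‖ * ‖p i‖
  have hs : ∀ᶠ t : ℝ in nhds 0, ∀ i, |t * D i| ≤ 1 / 2 := by
    refine Filter.eventually_all.mpr fun i => ?_
    have h : Filter.Tendsto (fun t : ℝ => |t * D i|) (nhds 0) (nhds 0) := by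
      have : Continuous fun t : ℝ => |t * D i| := by fun_prop
      simpa using this.tendsto 0
    exact h.eventually_le_const (by norm_num)
  have hsq (t : ℝ) (ht : ∀ i, |t * D i| ≤ 1 / 2) (i : Fin d) :
      1 / 2 ≤ √(1 + t * D i) ∧ √(1 + t * D i) ≤ 2 := by
    have := abs_le.mp (ht i)
    exact ⟨Real.le_sqrt_of_sq_le (by linarith), (Real.sqrt_le_left zero_le_two).mpr (by linarith)⟩
  have hXR (t : ℝ) (ht : ∀ i, |t * D i| ≤ 1 / 2) (z : Vec d) : ‖X t z‖ ≤ R z := by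
    refine (norm_add_le _ _).trans (add_le_add_right (norm_sum_le_of_le _ fun i _ => ?_) _)
    rw [norm_smul, Real.norm_eq_abs, abs_mul, abs_of_nonneg (Real.sqrt_nonneg _)]
    gcongr
    exacts [(hsq t ht i).2, hcoord z i]
  have hXQ (t : ℝ) (ht : ∀ i, |t * D i| ≤ 1 / 2) (z : Vec d) : ‖X' t z‖ ≤ Q z := by
    refine norm_sum_le_of_le _ fun i _ => ?_
    have h := (hsq t ht i).1
    rw [norm_smul, Real.norm_eq_abs, abs_mul, abs_div, abs_of_nonneg (by positivity :
      0 ≤ 2 * √(1 + t * D i))]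
    gcongr
    · exact div_le_self (abs_nonneg _) (by linarith)
    · exact hcoord z i
  have hRg : PolyGrowth R := (PolyGrowth.const _).add (PolyGrowth.sum _ fun i _ =>
    ((PolyGrowth.const 2).mul PolyGrowth.norm).mul (PolyGrowth.const _))
  have hQg : PolyGrowth Q := PolyGrowth.sum _ fun i _ =>
    ((PolyGrowth.const _).mul PolyGrowth.norm).mul (PolyGrowth.const _)
  have hR0 (z : Vec d) : 0 ≤ R z := by positivity
  have hRc : Continuous R := by fun_prop
  have hQc : Continuous Q := by fun_prop
  have hfd : Continuous (fderiv ℝ f) := hf.continuous_fderiv one_ne_zero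
  have hw : Continuous (gaussWeight : Vec d → ℝ) := contDiff_gaussWeight.continuous
  obtain ⟨a, n, ha, hbd⟩ := hf1
  have hX0 (z : Vec d) : X 0 z = m + ∑ i, z i • p i := by simp [X]
  have key := (hasDerivAt_integral_of_dominated_loc_of_deriv_le (μ := volume)
    (F := fun t z => gaussWeight z * f (X t z))
    (F' := fun t z => gaussWeight z * fderiv ℝ f (X t z) (X' t z)) (x₀ := (0 : ℝ))
    (bound := fun z => gaussWeight z * (a * (1 + R z) ^ n * Q z)) hs
    (.of_forall fun t => (hw.mul (hf.continuous.comp (hXc t))).aestronglyMeasurable)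
    (integrable_gaussWeight_mul (hf0.comp (T := X 0) (hRg.mono fun z => ?_))
      (hf.continuous.comp (hXc 0)))
    (hw.mul ((hfd.comp (hXc 0)).clm_apply (hX'c 0))).aestronglyMeasurable
    (.of_forall fun z t ht => ?_)
    (integrable_gaussWeight_mul
      (((PolyGrowth.const a).mul (((PolyGrowth.const 1).add hRg).pow n)).mul hQg)
      (by fun_prop))
    (.of_forall fun z t ht => ?_)).2
  · simpa [X, X', div_eq_mul_inv] using key
  · rw [abs_norm, abs_of_nonneg (hR0 z)]
    exact hXR 0 (by simp) z
  · rw [norm_mul, Real.norm_of_nonneg (gaussWeight_pos z).le]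
    refine mul_le_mul_of_nonneg_left (((fderiv ℝ f (X t z)).le_opNorm _).trans ?_)
      (gaussWeight_pos z).le
    have h1 := hbd (X t z)
    rw [abs_norm] at h1
    have := hXR t ht z
    have := hXQ t ht z
    have := hR0 z
    calc ‖fderiv ℝ f (X t z)‖ * ‖X' t z‖ ≤ (a * (1 + ‖X t z‖) ^ n) * Q z := by gcongr
      _ ≤ a * (1 + R z) ^ n * Q z := by
        have : 0 ≤ Q z := (norm_nonneg _).trans ‹‖X' t z‖ ≤ Q z›
        gcongr
  · refine HasDerivAt.const_mul _ ?_
    refine ((hf.differentiable one_ne_zero _).hasFDerivAt).comp_hasDerivAt t ?_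
    refine HasDerivAt.const_add _ (HasDerivAt.fun_sum fun i _ => ?_)
    refine HasDerivAt.smul_const (HasDerivAt.mul_const ?_ _) _
    have h := (hsq t ht i).1
    have hne : 1 + t * D i ≠ 0 := by
      intro h0
      rw [h0, Real.sqrt_zero] at h
      norm_num at h
    simpa using (((hasDerivAt_id t).mul_const (D i)).const_add 1).sqrt hne

lemma abs_le_frobNorm (A : Mat d) (i j : Fin d) : |A i j| ≤ frobNorm A := by
  rw [frobNorm, ← Real.sqrt_sq_eq_abs]
  refine Real.sqrt_le_sqrt ?_
  calc A i j ^ 2 ≤ ∑ j, A i j ^ 2 :=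
        Finset.single_le_sum (f := fun j => A i j ^ 2) (fun _ _ => sq_nonneg _) (Finset.mem_univ j)
    _ ≤ ∑ i, ∑ j, A i j ^ 2 :=
        Finset.single_le_sum (f := fun i => ∑ j, A i j ^ 2)
          (fun _ _ => Finset.sum_nonneg fun _ _ => sq_nonneg _) (Finset.mem_univ i)

lemma fderiv_fderiv_apply_eq_hess {f : Vec d → ℝ} (hf : ContDiff ℝ 2 f) (x u v : Vec d) :
    fderiv ℝ (fun y => fderiv ℝ f y u) x v = ∑ i, ∑ j, v i * u j * hess f x i j := by
  have hd : DifferentiableAt ℝ (fderiv ℝ f) x :=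
    (hf.fderiv_right (m := 1) (by norm_num)).differentiable one_ne_zero x
  have h (u v : Vec d) :
      fderiv ℝ (fun y => fderiv ℝ f y u) x v = fderiv ℝ (fderiv ℝ f) x v u := by
    rw [fderiv_clm_apply hd (differentiableAt_const u)]
    simp
  have hexp (w : Vec d) : w = ∑ i, w i • EuclideanSpace.single i (1 : ℝ) := by
    simpa using ((EuclideanSpace.basisFun (Fin d) ℝ).sum_repr w).symm
  simp only [hess, of_apply, h]
  conv_lhs => rw [hexp u, hexp v]
  simp only [map_sum, map_smul, _root_.sum_apply, _root_.smul_apply,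
    smul_eq_mul, Finset.mul_sum]
  rw [Finset.sum_comm]
  refine Finset.sum_congr rfl fun i _ => Finset.sum_congr rfl fun j _ => by ring

lemma trace_mul_congr_diagonal (A P : Mat d) (D : Fin d → ℝ) :
    (A * (P * diagonal D * Pᵀ)).trace = ∑ k, D k * ∑ i, ∑ j, P i k * P j k * A i j := by
  have h : (A * (P * diagonal D * Pᵀ)).trace = (diagonal D * (Pᵀ * A * P)).trace := by
    rw [Matrix.mul_assoc P, ← Matrix.mul_assoc A, Matrix.trace_mul_comm, Matrix.mul_assoc,
      Matrix.mul_assoc Pᵀ]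
  rw [h]
  simp only [Matrix.trace, diag_apply, diagonal_mul]
  refine Finset.sum_congr rfl fun k _ => ?_
  simp only [Matrix.mul_apply, transpose_apply, Finset.sum_mul]
  rw [Finset.sum_comm]
  congr! 3
  ring

/-- **Price's theorem** (first equality of Proposition 2.1).  For a twice continuously
differentiable `f` with polynomial growth of `f`, `∇f` and `∇²f`, the map
`t ↦ ∫ f dN(m, Σ + tH)` is differentiable at `t = 0` with derivative
`(1/2) ∫ tr(∇²f(x) H) dN(m,Σ)(x)`. -/
theorem price_theorem
    (d : ℕ) (hd : 0 < d) (m : Vec d) (S H : Mat d)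
    (hS : S.PosDef) (hH : H.IsSymm)
    (f : Vec d → ℝ) (hf : ContDiff ℝ 2 f)
    (hgrowth : ∃ a : ℝ, 0 < a ∧ ∃ n : ℕ, ∀ x : Vec d,
      |f x| ≤ a * (1 + ‖x‖) ^ n ∧
      ‖gradient f x‖ ≤ a * (1 + ‖x‖) ^ n ∧
      frobNorm (hess f x) ≤ a * (1 + ‖x‖) ^ n) :
    HasDerivAt (fun t : ℝ => ∫ x, f x ∂(gaussian m (S + t • H)))
      ((1 / 2) * ∫ x, (hess f x * H).trace ∂(gaussian m S)) 0 := by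
  obtain ⟨a, ha, n, hg⟩ := hgrowth
  obtain ⟨P, D, hP, rfl, rfl⟩ := exists_congr_diagonal hS hH
  let p : Fin d → Vec d := fun i => WithLp.toLp 2 (P.col i)
  have hf1 : ContDiff ℝ 1 f := hf.of_le (by norm_num)
  have hfd : ContDiff ℝ 1 (fderiv ℝ f) := hf.fderiv_right (by norm_num)
  have hf0g : PolyGrowth f := ⟨a, n, ha.le, fun x => (hg x).1⟩
  have hf1g : PolyGrowth fun x => ‖fderiv ℝ f x‖ := ⟨a, n, ha.le, fun x => by
    rw [abs_norm, ← (InnerProductSpace.toDual ℝ (Vec d)).symm.norm_map]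
    exact (hg x).2.1⟩
  have hf2g (u v : Vec d) : PolyGrowth fun x => fderiv ℝ (fun y => fderiv ℝ f y u) x v := by
    simp only [fderiv_fderiv_apply_eq_hess hf]
    exact PolyGrowth.sum _ fun i _ => PolyGrowth.sum _ fun j _ => (PolyGrowth.const _).mul
      ⟨a, n, ha.le, fun x => (abs_le_frobNorm _ i j).trans (hg x).2.2⟩
  have hPz (z : Vec d) : toEuclideanCLM (𝕜 := ℝ) P z = ∑ i, z i • p i :=
    toEuclideanCLM_eq_sum P z
  have hA : PolyGrowth fun z => ‖m + toEuclideanCLM (𝕜 := ℝ) P z‖ :=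
    ((PolyGrowth.const ‖m‖).add ((PolyGrowth.const ‖toEuclideanCLM (𝕜 := ℝ) P‖).mul
      PolyGrowth.norm)).mono fun z => by
        rw [abs_norm]
        exact ((norm_add_le _ _).trans (add_le_add_right (ContinuousLinearMap.le_opNorm _ _) _)).trans
          (le_abs_self _)
  have htr (x : Vec d) : (hess f x * (P * diagonal D * Pᵀ)).trace =
      ∑ i, D i * fderiv ℝ (fun y => fderiv ℝ f y (p i)) x (p i) := by
    simp only [trace_mul_congr_diagonal, fderiv_fderiv_apply_eq_hess hf]
    rfl
  have hsqrt : ∀ᶠ t : ℝ in nhds 0, ∀ i, 0 < 1 + t * D i := by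
    refine Filter.eventually_all.mpr fun i => ?_
    have hc : Continuous fun t : ℝ => 1 + t * D i := by fun_prop
    exact hc.continuousAt.eventually (lt_mem_nhds (by simp))
  have hcov : (fun t : ℝ => ∫ x, f x ∂(gaussian m (P * Pᵀ + t • (P * diagonal D * Pᵀ)))) =ᶠ[nhds 0]
      fun t => √((2 * π) ^ d)⁻¹ *
        ∫ z, gaussWeight z * f (m + ∑ i, (√(1 + t * D i) * z i) • p i) := by
    filter_upwards [hsqrt] with t ht
    let σ : Fin d → ℝ := fun i => √(1 + t * D i)
    have hB : P * Pᵀ + t • (P * diagonal D * Pᵀ) = (P * diagonal σ) * (P * diagonal σ)ᵀ := by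
      have hdiag : diagonal σ * diagonal σ = 1 + t • diagonal D := by
        rw [diagonal_mul_diagonal, ← diagonal_one, ← diagonal_smul, diagonal_add]
        congr 1 with i
        simpa using Real.mul_self_sqrt (ht i).le
      rw [transpose_mul, diagonal_transpose, Matrix.mul_assoc P (diagonal σ),
        ← Matrix.mul_assoc (diagonal σ), hdiag]
      simp [Matrix.add_mul, Matrix.mul_add, Matrix.mul_assoc]
    have hBdet : (P * diagonal σ).det ≠ 0 := by
      rw [det_mul, det_diagonal]
      exact mul_ne_zero hP (Finset.prod_ne_zero_iff.mpr fun i _ => (Real.sqrt_pos.mpr (ht i)).ne')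
    rw [hB, integral_gaussian_mul_transpose m hBdet]
    congr! 6 with z
    rw [toEuclideanCLM_eq_sum]
    refine Finset.sum_congr rfl fun i _ => ?_
    ext j
    simp [p, σ]
    ring
  refine HasDerivAt.congr_of_eventuallyEq (((hasDerivAt_integral_gaussWeight_sqrt m p D hf1 hf0g
    hf1g).const_mul _).congr_deriv (Eq.symm ?_)) hcov
  rw [integral_gaussian_mul_transpose m hP, mul_left_comm]
  congr 1
  simp only [htr, ← hPz, map_sum, map_smul, smul_eq_mul, Finset.mul_sum]
  let g : Fin d → Vec d → ℝ := fun i z => fderiv ℝ f (m + toEuclideanCLM (𝕜 := ℝ) P z) (p i)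
  have hgc (i : Fin d) : ContDiff ℝ 1 (g i) :=
    (hfd.comp (contDiff_const.add (ContinuousLinearMap.contDiff _))).clm_apply contDiff_const
  have hgg (i : Fin d) : PolyGrowth (g i) :=
    ((hf1g.comp hA).mul (PolyGrowth.const ‖p i‖)).mono fun z =>
      ((fderiv ℝ f _).le_opNorm _).trans (le_abs_self _)
  have hgd (i : Fin d) (z : Vec d) : fderiv ℝ (g i) z (EuclideanSpace.single i 1) =
      fderiv ℝ (fun y => fderiv ℝ f y (p i)) (m + toEuclideanCLM (𝕜 := ℝ) P z) (p i) := by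
    have hd := ((hfd.clm_apply (contDiff_const (c := p i))).differentiable one_ne_zero
      (m + toEuclideanCLM (𝕜 := ℝ) P z)).hasFDerivAt
    have hc : HasFDerivAt (g i) _ z := HasFDerivAt.comp
      (f := fun z => m + toEuclideanCLM (𝕜 := ℝ) P z) z hd
      ((toEuclideanCLM (𝕜 := ℝ) P).hasFDerivAt.const_add m)
    rw [hc.fderiv, ContinuousLinearMap.comp_apply, hPz (EuclideanSpace.single i 1)]
    simp [PiLp.single_apply]
  have hgdg (i : Fin d) : PolyGrowth fun z => fderiv ℝ (g i) z (EuclideanSpace.single i 1) := by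
    simp only [hgd]
    exact (hf2g (p i) (p i)).comp hA
  have hint (i : Fin d) : Integrable fun z => gaussWeight z *
      fderiv ℝ (g i) z (EuclideanSpace.single i 1) :=
    integrable_gaussWeight_mul (hgdg i)
      (((hgc i).continuous_fderiv one_ne_zero).clm_apply continuous_const)
  have hint' (i : Fin d) : Integrable fun z => gaussWeight z * (z i * g i z) :=
    integrable_gaussWeight_mul ((PolyGrowth.coord i).mul (hgg i))
      ((by fun_prop : Continuous fun z : Vec d => z i).mul (hgc i).continuous)
  simp only [← hgd]
  calc 1 / 2 * ∫ z, ∑ i, gaussWeight z * (D i * fderiv ℝ (g i) z (EuclideanSpace.single i 1))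
      = ∑ i, D i / 2 * ∫ z, gaussWeight z * fderiv ℝ (g i) z (EuclideanSpace.single i 1) := by
        simp only [mul_left_comm (gaussWeight _)]
        rw [integral_finsetSum _ fun i _ => (hint i).const_mul _, Finset.mul_sum]
        simp only [integral_const_mul]
        exact Finset.sum_congr rfl fun i _ => by ring
    _ = ∑ i, D i / 2 * ∫ z, gaussWeight z * (z i * g i z) := by
        simp only [integral_gaussWeight_coord_mul (hgc _) (hgg _) _ (hgdg _)]
    _ = ∫ z, ∑ i, gaussWeight z * (D i / 2 * z i * g i z) := by
        simp only [mul_assoc, mul_left_comm (gaussWeight _)]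
        rw [integral_finsetSum _ fun i _ => ?_]
        · simp only [integral_const_mul]
        · simpa only [mul_left_comm (gaussWeight _)] using (hint' i).const_mul (D i / 2)
end
end

section
/- Fixed point of the proximal Bures–Wasserstein gradient descent update with exact gradients: Suppose q_* = N(m_*, Σ_*) satisfies the stationarity conditions ∫ ∇U dq_* = 0 and ∫ ∇²U dq_* = Σ_*^{-1}, and let γ > 0 satisfy γ²·Σ_*^{-1} ⪯ Σ_* (Loewner order). Set M = I − γ·∫ ∇²U dq_* = I − γΣ_*^{-1} and Σ_half = M Σ_* Mᵀ. Then m_* − γ·∫ ∇U dq_* = m_*, and (1/2)·( Σ_half + 2γI + ( Σ_half (Σ_half + 4γI) )^{1/2} ) = Σ_*, where X^{1/2} denotes the unique positive-semidefinite square root of a positive-semidefinite matrix X. Hence q_* is a fixed point of one step of proximal Bures–Wasserstein gradient descent with exact gradients. -/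
open MeasureTheory Matrix Real
open scoped RealInnerProductSpace

noncomputable section

variable {d : ℕ}

/-- Integral of the gradient of `U` against a measure. -/
def intGrad (U : Vec d → ℝ) (q : Measure (Vec d)) : Vec d := ∫ x, gradient U x ∂q

/-- Entrywise integral of the Hessian of `U` against a measure. -/
def intHess (U : Vec d → ℝ) (q : Measure (Vec d)) : Mat d :=
  Matrix.of fun i j => ∫ x, hess U x i j ∂q

/-- The variational free energy of the Gaussian `N(m,S)`:
`F(m,Σ) = ∫ U dN(m,Σ) − (1/2)·log((2πe)^d · det Σ)`. -/
def freeEnergy (U : Vec d → ℝ) (m : Vec d) (S : Mat d) : ℝ :=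
  (∫ x, U x ∂(gaussian m S)) - (1 / 2) * Real.log ((2 * π * Real.exp 1) ^ d * S.det)
open scoped MatrixOrder Matrix.Norms.L2Operator in
/-- A positive-semidefinite real matrix has at most one positive-semidefinite square root. -/
theorem Matrix.PosSemidef.eq_of_mul_self_eq_mul_self {n : Type*} [Fintype n] [DecidableEq n]
    {A B : Matrix n n ℝ} (hA : A.PosSemidef) (hB : B.PosSemidef) (h : A * A = B * B) :
    A = B := by
  rw [← CFC.sqrt_mul_self A hA.nonneg, h, CFC.sqrt_mul_self B hB.nonneg]

/-- One exact-gradient step from covariance `S` gives `S - 2γ I + γ² S⁻¹`. -/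
theorem one_sub_smul_inv_mul_mul_transpose {n : Type*} [Fintype n] [DecidableEq n]
    {S : Matrix n n ℝ} (hS : S.PosDef) (γ : ℝ) :
    (1 - γ • S⁻¹) * S * (1 - γ • S⁻¹)ᵀ = S - (2 * γ) • 1 + (γ ^ 2) • S⁻¹ := by
  have hT : (S⁻¹)ᵀ = S⁻¹ := by
    rw [← conjTranspose_eq_transpose_of_trivial]
    exact hS.isHermitian.inv.eq
  have hu : IsUnit S.det := S.isUnit_iff_isUnit_det.mp hS.isUnit
  have hl : S⁻¹ * S = 1 := S.nonsing_inv_mul hu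
  have hr : S * S⁻¹ = 1 := S.mul_nonsing_inv hu
  simp only [transpose_sub, transpose_one, transpose_smul, hT, sub_mul, mul_sub, one_mul, mul_one,
    smul_mul_assoc, mul_smul_comm, hl, hr, smul_sub, smul_smul]
  module

/-- The square-root argument of the entropy-proximal step is a perfect square. -/
theorem half_step_mul_add_smul_one {n : Type*} [Fintype n] [DecidableEq n]
    {S : Matrix n n ℝ} (hS : S.PosDef) (γ : ℝ) :
    (S - (2 * γ) • 1 + (γ ^ 2) • S⁻¹) * (S - (2 * γ) • 1 + (γ ^ 2) • S⁻¹ + (4 * γ) • 1) =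
      (S - (γ ^ 2) • S⁻¹) * (S - (γ ^ 2) • S⁻¹) := by
  have hu : IsUnit S.det := S.isUnit_iff_isUnit_det.mp hS.isUnit
  have hl : S⁻¹ * S = 1 := S.nonsing_inv_mul hu
  have hr : S * S⁻¹ = 1 := S.mul_nonsing_inv hu
  simp only [sub_mul, mul_sub, add_mul, mul_add, one_mul, mul_one,
    smul_mul_assoc, mul_smul_comm, hl, hr, smul_sub, smul_add, smul_smul]
  module

/-- **Fixed point of the proximal Bures–Wasserstein gradient descent update with
exact gradients.**  If `q_* = N(m_*, Σ_*)` satisfies the stationarity conditions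
and `γ²·Σ_*⁻¹ ⪯ Σ_*`, then with `M = I − γ·∫∇²U dq_*` and `Σ_half = M Σ_* Mᵀ`,
the exact-gradient step fixes the mean, and the JKO (entropy-proximal) step maps
`Σ_half` back to `Σ_*`; here the square root is the unique positive-semidefinite
square root, encoded by quantifying over all PSD matrices `R` with
`R·R = Σ_half(Σ_half + 4γI)`. -/
theorem bw_proximal_gradient_fixed_point
    (d : ℕ) (hd : 0 < d) (U : Vec d → ℝ) (μ L : ℝ) (hμ : 0 < μ) (hμL : μ ≤ L)
    (hU : ContDiff ℝ 2 U)
    (hconv : ∀ x : Vec d,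
      (hess U x - μ • 1).PosSemidef ∧ ((L • (1 : Mat d)) - hess U x).PosSemidef)
    (mstar : Vec d) (Sstar : Mat d) (hSstar : Sstar.PosDef)
    (hstat1 : intGrad U (gaussian mstar Sstar) = 0)
    (hstat2 : intHess U (gaussian mstar Sstar) = Sstar⁻¹)
    (γ : ℝ) (hγ : 0 < γ)
    (hγsmall : (Sstar - (γ ^ 2) • Sstar⁻¹).PosSemidef) :
    let M : Mat d := 1 - γ • intHess U (gaussian mstar Sstar)
    let Shalf : Mat d := M * Sstar * Mᵀ
    (mstar - γ • intGrad U (gaussian mstar Sstar) = mstar) ∧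
      ∀ R : Mat d, R.PosSemidef → R * R = Shalf * (Shalf + (4 * γ) • 1) →
        (2⁻¹ : ℝ) • (Shalf + (2 * γ) • 1 + R) = Sstar := by
  intro M Shalf
  refine ⟨by rw [hstat1, smul_zero, sub_zero], fun R hR hRR => ?_⟩
  have hShalf : Shalf = Sstar - (2 * γ) • 1 + (γ ^ 2) • Sstar⁻¹ := by
    simp only [Shalf, M, hstat2]
    exact one_sub_smul_inv_mul_mul_transpose hSstar γ
  rw [hShalf, half_step_mul_add_smul_one hSstar γ] at hRR
  rw [hR.eq_of_mul_self_eq_mul_self hγsmall hRR, hShalf]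
  module
end
end

section
/- Bound on the covariance-weighted Hessian norm: Let q = N(m,Σ) be a Gaussian with positive-definite covariance, let q_* = N(m_*,Σ_*) satisfy the stationarity conditions ∫ ∇U dq_* = 0 and ∫ ∇²U dq_* = Σ_*^{-1}, and let ψ be any coupling of q and q_*. Then ∫ tr( ∇²U(z) · Σ · ∇²U(z) ) dq(z) ≤ L(2√κ + κ) · ∫ D_U(x, x_*) dψ(x, x_*) + 3dL. -/
open MeasureTheory Matrix Real
open scoped RealInnerProductSpace

noncomputable section

variable {d : ℕ}

/-- Bregman divergence of `U`: `D_U(x,y) = U(x) − U(y) − ⟨∇U(y), x − y⟩`. -/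
def bregman (U : Vec d → ℝ) (x y : Vec d) : ℝ := U x - U y - ⟪gradient U y, x - y⟫

/-- `ψ` is a coupling of `p` and `q`: a probability measure on the product whose
marginals are `p` and `q`. -/
def IsCoupling (ψ : Measure (Vec d × Vec d)) (p q : Measure (Vec d)) : Prop :=
  IsProbabilityMeasure ψ ∧ ψ.map Prod.fst = p ∧ ψ.map Prod.snd = q

section SecondOrder

variable {E : Type*} [NormedAddCommGroup E] [InnerProductSpace ℝ E]

theorem add_deriv_add_half_le_of_le_second_deriv {h h' h'' : ℝ → ℝ} {c : ℝ}
    (hh : ∀ t, HasDerivAt h (h' t) t) (hh' : ∀ t, HasDerivAt h' (h'' t) t)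
    (hc : ∀ t, c ≤ h'' t) : h 0 + h' 0 + c / 2 ≤ h 1 := by
  have hmono' : Monotone fun t => h' t - c * t :=
    monotone_of_hasDerivAt_nonneg (f' := fun t => h'' t - c)
      (fun t => by simpa using! (hh' t).sub ((hasDerivAt_id t).const_mul c))
      (fun t => sub_nonneg.2 (hc t))
  have hmono : MonotoneOn (fun t => h t - h' 0 * t - c / 2 * t ^ 2) (Set.Icc 0 1) := by
    have hd (t : ℝ) : HasDerivAt (fun t => h t - h' 0 * t - c / 2 * t ^ 2)
        (h' t - h' 0 - c * t) t := by
      convert! ((hh t).sub ((hasDerivAt_id t).const_mul (h' 0))).sub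
        ((hasDerivAt_pow 2 t).const_mul (c / 2)) using 1
      simp
      ring
    refine monotoneOn_of_deriv_nonneg (convex_Icc 0 1)
      (fun t _ => (hd t).continuousAt.continuousWithinAt)
      (fun t _ => (hd t).differentiableAt.differentiableWithinAt) fun t ht => ?_
    rw [interior_Icc] at ht
    have := hmono' ht.1.le
    simp only [mul_zero, sub_zero] at this
    rw [(hd t).deriv]
    linarith
  have := hmono (Set.left_mem_Icc.2 zero_le_one) (Set.right_mem_Icc.2 zero_le_one) zero_le_one
  simp only at this
  linarith

theorem le_taylor_of_le_hessian {U : E → ℝ} (hU : ContDiff ℝ 2 U) {c : ℝ}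
    (hc : ∀ x v, c * ‖v‖ ^ 2 ≤ fderiv ℝ (fderiv ℝ U) x v v) (x y : E) :
    c / 2 * ‖x - y‖ ^ 2 ≤ U x - U y - fderiv ℝ U y (x - y) := by
  have hline (t : ℝ) : HasDerivAt (fun t : ℝ => y + t • (x - y)) (x - y) t := by
    simpa using ((hasDerivAt_id t).smul_const (x - y)).const_add y
  have hD : Differentiable ℝ (fderiv ℝ U) :=
    (hU.fderiv_right (m := 1) (by norm_num)).differentiable (by norm_num)
  have key := add_deriv_add_half_le_of_le_second_deriv
    (h := fun t : ℝ => U (y + t • (x - y)))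
    (h' := fun t => fderiv ℝ U (y + t • (x - y)) (x - y))
    (h'' := fun t => fderiv ℝ (fderiv ℝ U) (y + t • (x - y)) (x - y) (x - y))
    (fun t => ((hU.differentiable (by norm_num)) _).hasFDerivAt.comp_hasDerivAt t (hline t))
    (fun t => by
      have := ((hD _).hasFDerivAt.comp_hasDerivAt t (hline t)).clm_apply
        (hasDerivAt_const t (x - y))
      simpa using this)
    (fun t => hc _ (x - y))
  simp only [zero_smul, add_zero, one_smul, add_sub_cancel] at key
  linarith

theorem taylor_le_of_hessian_le {U : E → ℝ} (hU : ContDiff ℝ 2 U) {c : ℝ}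
    (hc : ∀ x v, fderiv ℝ (fderiv ℝ U) x v v ≤ c * ‖v‖ ^ 2) (x y : E) :
    U x - U y - fderiv ℝ U y (x - y) ≤ c / 2 * ‖x - y‖ ^ 2 := by
  have hf : fderiv ℝ (-U) = -fderiv ℝ U := by
    ext1 z
    simp [fderiv_neg]
  have := le_taylor_of_le_hessian (U := -U) hU.neg (c := -c) (fun x v => by
    rw [hf, fderiv_neg]
    simpa using hc x v) x y
  rw [hf] at this
  simp only [Pi.neg_apply, _root_.neg_apply] at this
  linarith

end SecondOrder

section Bregman

variable {U : Vec d → ℝ} {μ L : ℝ}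

theorem le_bregman (hU : ContDiff ℝ 2 U)
    (hc : ∀ x v, μ * ‖v‖ ^ 2 ≤ fderiv ℝ (fderiv ℝ U) x v v) (x y : Vec d) :
    μ / 2 * ‖x - y‖ ^ 2 ≤ bregman U x y := by
  rw [bregman, inner_gradient_left]
  exact le_taylor_of_le_hessian hU hc x y

theorem bregman_le (hU : ContDiff ℝ 2 U)
    (hc : ∀ x v, fderiv ℝ (fderiv ℝ U) x v v ≤ L * ‖v‖ ^ 2) (x y : Vec d) :
    bregman U x y ≤ L / 2 * ‖x - y‖ ^ 2 := by
  rw [bregman, inner_gradient_left]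
  exact taylor_le_of_hessian_le hU hc x y

theorem bregman_add_swap (U : Vec d → ℝ) (x y : Vec d) :
    bregman U x y + bregman U y x = ⟪gradient U x - gradient U y, x - y⟫ := by
  simp only [bregman, inner_sub_left, inner_sub_right]
  ring

/-- Strong monotonicity of the gradient of a strongly convex function. -/
theorem mul_norm_sub_sq_le_inner_gradient_sub (hU : ContDiff ℝ 2 U)
    (hc : ∀ x v, μ * ‖v‖ ^ 2 ≤ fderiv ℝ (fderiv ℝ U) x v v) (x y : Vec d) :
    μ * ‖x - y‖ ^ 2 ≤ ⟪gradient U x - gradient U y, x - y⟫ := by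
  have h₁ := le_bregman hU hc x y
  have h₂ := le_bregman hU hc y x
  rw [norm_sub_rev y x] at h₂
  rw [← bregman_add_swap]
  linarith

theorem norm_gradient_sub_sq_le_bregman (hL : 0 < L) (hU : ContDiff ℝ 2 U)
    (hpos : ∀ x v, 0 ≤ fderiv ℝ (fderiv ℝ U) x v v)
    (hc : ∀ x v, fderiv ℝ (fderiv ℝ U) x v v ≤ L * ‖v‖ ^ 2) (x y : Vec d) :
    ‖gradient U x - gradient U y‖ ^ 2 ≤ 2 * L * bregman U x y := by
  set g := gradient U x - gradient U y with hg
  set z := x - L⁻¹ • g with hz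
  have h₁ : 0 ≤ bregman U z y := by
    simpa using le_bregman (μ := 0) hU (by simpa using hpos) z y
  have h₂ := bregman_le hU hc z x
  have hzx : z - x = -(L⁻¹ • g) := by simp [hz]
  have h₃ : bregman U z y = bregman U z x + bregman U x y + ⟪g, z - x⟫ := by
    simp only [bregman, hg, inner_sub_left, inner_sub_right]
    ring
  rw [hzx, norm_neg, norm_smul, norm_inv, Real.norm_of_nonneg hL.le] at h₂
  rw [hzx, inner_neg_right, inner_smul_right, real_inner_self_eq_norm_sq] at h₃
  have h₄ : L / 2 * (L⁻¹ * ‖g‖) ^ 2 - L⁻¹ * ‖g‖ ^ 2 = -(‖g‖ ^ 2 / (2 * L)) := by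
    field_simp
    ring
  have h₅ : ‖g‖ ^ 2 / (2 * L) ≤ bregman U x y := by linarith
  rwa [div_le_iff₀ (by positivity), mul_comm] at h₅

/-- Cocoercivity of the gradient of a smooth convex function. -/
theorem norm_gradient_sub_sq_le_inner (hL : 0 < L) (hU : ContDiff ℝ 2 U)
    (hpos : ∀ x v, 0 ≤ fderiv ℝ (fderiv ℝ U) x v v)
    (hc : ∀ x v, fderiv ℝ (fderiv ℝ U) x v v ≤ L * ‖v‖ ^ 2) (x y : Vec d) :
    ‖gradient U x - gradient U y‖ ^ 2 ≤ L * ⟪gradient U x - gradient U y, x - y⟫ := by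
  have h₁ := norm_gradient_sub_sq_le_bregman hL hU hpos hc x y
  have h₂ := norm_gradient_sub_sq_le_bregman hL hU hpos hc y x
  rw [norm_sub_rev] at h₂
  rw [← bregman_add_swap]
  linarith

theorem lipschitzWith_gradient (hL : 0 < L) (hU : ContDiff ℝ 2 U)
    (hpos : ∀ x v, 0 ≤ fderiv ℝ (fderiv ℝ U) x v v)
    (hc : ∀ x v, fderiv ℝ (fderiv ℝ U) x v v ≤ L * ‖v‖ ^ 2) :
    LipschitzWith L.toNNReal (gradient U) := by
  refine LipschitzWith.of_dist_le_mul fun x y => ?_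
  rw [dist_eq_norm, dist_eq_norm, Real.coe_toNNReal _ hL.le]
  have h₁ := norm_gradient_sub_sq_le_inner hL hU hpos hc x y
  have h₂ := real_inner_le_norm (gradient U x - gradient U y) (x - y)
  rcases (norm_nonneg (gradient U x - gradient U y)).eq_or_lt with h | h
  · rw [← h]; positivity
  · refine le_of_mul_le_mul_left ?_ h
    nlinarith [mul_le_mul_of_nonneg_left h₂ hL.le]

end Bregman

section Matrices

theorem matVec_eq_toEuclideanLin (A : Mat d) (x : Vec d) : matVec A x = A.toEuclideanLin x := rfl

theorem inner_matVec (A : Mat d) (x y : Vec d) :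
    ⟪x, matVec A y⟫ = ∑ i, ∑ j, x i * (A i j * y j) := by
  simp [matVec, PiLp.inner_apply, mulVec, dotProduct, Finset.mul_sum, mul_comm]

theorem inner_matVec_comm {A : Mat d} (hA : A.IsHermitian) (x y : Vec d) :
    ⟪x, matVec A y⟫ = ⟪matVec A x, y⟫ := by
  rw [real_inner_comm _ (matVec A x), inner_matVec, inner_matVec, Finset.sum_comm]
  refine Finset.sum_congr rfl fun i _ => Finset.sum_congr rfl fun j _ => ?_
  rw [← hA.apply i j]
  simp only [star_trivial]
  ring

theorem Matrix.PosSemidef.inner_matVec_nonneg {A : Mat d} (hA : A.PosSemidef) (x : Vec d) :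
    0 ≤ ⟪x, matVec A x⟫ := by
  have := hA.dotProduct_mulVec_nonneg x.ofLp
  simpa [inner_matVec, dotProduct, mulVec, Finset.mul_sum] using this

theorem Matrix.PosDef.exists_mul_norm_sq_le {A : Mat d} (hA : A.PosDef) :
    ∃ c > 0, ∀ x : Vec d, c * ‖x‖ ^ 2 ≤ ⟪x, matVec A x⟫ := by
  have hcont : Continuous fun x : Vec d => ⟪x, matVec A x⟫ := by
    simp only [inner_matVec]
    fun_prop
  have hpos (x : Vec d) (hx : x ≠ 0) : 0 < ⟪x, matVec A x⟫ := by
    have := hA.dotProduct_mulVec_pos (x := x.ofLp) (by simpa using hx)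
    simpa [inner_matVec, dotProduct, mulVec, Finset.mul_sum] using this
  obtain ⟨c, hc, hmin⟩ : ∃ c > 0, ∀ x ∈ Metric.sphere (0 : Vec d) 1, c ≤ ⟪x, matVec A x⟫ := by
    rcases (Metric.sphere (0 : Vec d) 1).eq_empty_or_nonempty with h | h
    · exact ⟨1, one_pos, by simp [h]⟩
    · obtain ⟨x, hx, hmin⟩ := (isCompact_sphere (0 : Vec d) 1).exists_isMinOn h hcont.continuousOn
      exact ⟨_, hpos x (ne_zero_of_mem_unit_sphere ⟨x, hx⟩), fun y hy => hmin hy⟩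
  refine ⟨c, hc, fun x => ?_⟩
  rcases eq_or_ne x 0 with rfl | hx
  · simp
  · have hx' : 0 < ‖x‖ := norm_pos_iff.2 hx
    have := hmin (‖x‖⁻¹ • x) (by simp [norm_smul, hx'.ne'])
    rw [matVec_eq_toEuclideanLin, map_smul, inner_smul_left, inner_smul_right,
      ← matVec_eq_toEuclideanLin] at this
    simp only [conj_trivial] at this
    calc c * ‖x‖ ^ 2 ≤ (‖x‖⁻¹ * (‖x‖⁻¹ * ⟪x, matVec A x⟫)) * ‖x‖ ^ 2 := by gcongr
      _ = ⟪x, matVec A x⟫ := by field_simp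

theorem Matrix.PosSemidef.trace_mul_nonneg {A B : Mat d} (hA : A.PosSemidef)
    (hB : B.PosSemidef) : 0 ≤ (A * B).trace := by
  obtain ⟨n, v, rfl⟩ := Matrix.posSemidef_iff_eq_sum_vecMulVec.1 hA
  rw [Finset.sum_mul, Matrix.trace_sum]
  refine Finset.sum_nonneg fun i _ => ?_
  rw [Matrix.vecMulVec_mul, Matrix.trace_vecMulVec, dotProduct_comm, ← Matrix.dotProduct_mulVec]
  exact hB.dotProduct_mulVec_nonneg (v i)

/-- If `0 ⪯ H ⪯ L` then `tr(H S H) ≤ L tr(S H)` for every positive semidefinite `S`. -/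
theorem trace_mul_mul_self_le {H S : Mat d} {L : ℝ} (hL : 0 < L) (hH : H.PosSemidef)
    (hHL : (L • (1 : Mat d) - H).PosSemidef) (hS : S.PosSemidef) :
    (H * S * H).trace ≤ L * (S * H).trace := by
  have hsq : (L • H - H * H).PosSemidef := by
    have h₁ := hH.conjTranspose_mul_mul_same (L • (1 : Mat d) - H)
    have h₂ := hHL.conjTranspose_mul_mul_same H
    rw [hHL.1.eq] at h₁
    rw [hH.1.eq] at h₂
    have h₃ := (h₁.add h₂).smul (inv_nonneg.2 hL.le)
    convert h₃ using 1
    simp only [Matrix.sub_mul, Matrix.mul_sub, Matrix.smul_mul, Matrix.mul_smul, Matrix.one_mul,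
      Matrix.mul_one, smul_sub, smul_add, smul_smul, Matrix.mul_assoc]
    rw [inv_mul_cancel_left₀ hL.ne', inv_mul_cancel₀ hL.ne', one_smul]
    abel
  have h := hS.trace_mul_nonneg hsq
  rw [Matrix.mul_sub, Matrix.mul_smul, Matrix.trace_sub, Matrix.trace_smul, smul_eq_mul] at h
  rw [Matrix.trace_mul_comm, ← Matrix.mul_assoc, Matrix.trace_mul_comm]
  linarith

theorem hess_apply {U : Vec d → ℝ} (hU : ContDiff ℝ 2 U) (x : Vec d) (i j : Fin d) :
    hess U x i j = fderiv ℝ (fderiv ℝ U) x (EuclideanSpace.single i 1)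
      (EuclideanSpace.single j 1) := by
  have hD : DifferentiableAt ℝ (fderiv ℝ U) x :=
    (hU.fderiv_right (m := 1) (by norm_num)).differentiable (by norm_num) x
  simp only [hess, of_apply]
  rw [fderiv_clm_apply hD (differentiableAt_const _)]
  simp

theorem inner_matVec_hess {U : Vec d → ℝ} (hU : ContDiff ℝ 2 U) (x v w : Vec d) :
    ⟪v, matVec (hess U x) w⟫ = fderiv ℝ (fderiv ℝ U) x v w := by
  have hsum (v : Vec d) : v = ∑ i, v i • EuclideanSpace.single i (1 : ℝ) := by
    simpa using ((EuclideanSpace.basisFun (Fin d) ℝ).sum_repr v).symm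
  conv_rhs => rw [hsum v, hsum w]
  simp only [inner_matVec, hess_apply hU, map_sum, map_smul, _root_.sum_apply, _root_.smul_apply,
    smul_eq_mul, Finset.mul_sum]
  rw [Finset.sum_comm]
  exact Finset.sum_congr rfl fun i _ => Finset.sum_congr rfl fun j _ => by ring

theorem inner_matVec_smul_one (c : ℝ) (v : Vec d) :
    ⟪v, matVec (c • (1 : Mat d)) v⟫ = c * ‖v‖ ^ 2 := by
  rw [matVec, Matrix.smul_mulVec, Matrix.one_mulVec, map_smul, inner_smul_right]
  simp

theorem inner_matVec_sub (A B : Mat d) (v : Vec d) :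
    ⟪v, matVec (A - B) v⟫ = ⟪v, matVec A v⟫ - ⟪v, matVec B v⟫ := by
  rw [matVec, Matrix.sub_mulVec, map_sub, inner_sub_right]
  rfl

end Matrices

section Gaussian

/-- The density of `N(m, S)` with respect to Lebesgue measure. -/
def gaussianDensity (m : Vec d) (S : Mat d) (x : Vec d) : ℝ :=
  Real.sqrt (((2 * π) ^ d * S.det)⁻¹) * Real.exp (-⟪x - m, matVec S⁻¹ (x - m)⟫ / 2)

theorem gaussianDensity_nonneg (m : Vec d) (S : Mat d) (x : Vec d) :
    0 ≤ gaussianDensity m S x := by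
  unfold gaussianDensity
  positivity

theorem differentiable_gaussianDensity (m : Vec d) (S : Mat d) :
    Differentiable ℝ (gaussianDensity m S) := by
  unfold gaussianDensity
  simp only [inner_matVec]
  fun_prop

theorem measurable_gaussianDensity (m : Vec d) (S : Mat d) :
    Measurable (gaussianDensity m S) :=
  (differentiable_gaussianDensity m S).continuous.measurable

theorem integrable_gaussian_iff {m : Vec d} {S : Mat d} {f : Vec d → ℝ} :
    Integrable f (gaussian m S) ↔ Integrable fun x => f x * gaussianDensity m S x := by
  change Integrable f (volume.withDensity fun x => ENNReal.ofReal (gaussianDensity m S x)) ↔ _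
  rw [integrable_withDensity_iff_integrable_smul'
    (measurable_gaussianDensity m S).ennreal_ofReal (by simp)]
  simp only [ENNReal.toReal_ofReal (gaussianDensity_nonneg m S _), smul_eq_mul, mul_comm]

theorem integral_gaussian_eq (m : Vec d) (S : Mat d) (f : Vec d → ℝ) :
    ∫ x, f x ∂(gaussian m S) = ∫ x, f x * gaussianDensity m S x := by
  change ∫ x, f x ∂(volume.withDensity fun x => ENNReal.ofReal (gaussianDensity m S x)) = _
  rw [integral_withDensity_eq_integral_toReal_smul
    (measurable_gaussianDensity m S).ennreal_ofReal (by simp)]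
  simp only [ENNReal.toReal_ofReal (gaussianDensity_nonneg m S _), smul_eq_mul, mul_comm]

theorem matVec_inv_matVec {S : Mat d} (hS : S.PosDef) (v : Vec d) :
    matVec S⁻¹ (matVec S v) = v := by
  ext i
  change (S⁻¹ *ᵥ (S *ᵥ v.ofLp)) i = v i
  rw [Matrix.mulVec_mulVec, Matrix.nonsing_inv_mul S hS.det_pos.ne'.isUnit, Matrix.one_mulVec]

theorem fderiv_gaussianDensity_matVec {m : Vec d} {S : Mat d} (hS : S.PosDef) (x v : Vec d) :
    fderiv ℝ (gaussianDensity m S) x (matVec S v) = -⟪v, x - m⟫ * gaussianDensity m S x := by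
  have hlin : HasFDerivAt (fun y : Vec d => matVec S⁻¹ (y - m))
      (S⁻¹.toEuclideanLin.toContinuousLinearMap) x :=
    S⁻¹.toEuclideanLin.toContinuousLinearMap.hasFDerivAt.comp x ((hasFDerivAt_id x).sub_const m)
  have hquad := ((hasFDerivAt_id x).sub_const m).inner ℝ hlin
  have h := ((hquad.neg.mul_const (2 : ℝ)⁻¹).exp).const_mul
    (Real.sqrt (((2 * π) ^ d * S.det)⁻¹))
  have h' : gaussianDensity m S = fun y => Real.sqrt (((2 * π) ^ d * S.det)⁻¹) *
      Real.exp ((-⟪y - m, matVec S⁻¹ (y - m)⟫) * (2 : ℝ)⁻¹) := rfl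
  have hval : (S⁻¹.toEuclideanLin.toContinuousLinearMap) (matVec S v) = v :=
    matVec_inv_matVec hS v
  have hcomm : ⟪matVec S v, matVec S⁻¹ (x - m)⟫ = ⟪v, x - m⟫ := by
    rw [inner_matVec_comm hS.inv.1, matVec_inv_matVec hS]
  rw [h']
  erw [h.fderiv]
  simp [hval, hcomm, fderivInnerCLM_apply, real_inner_comm]
  ring

theorem integrable_norm_sq_gaussian (m : Vec d) {S : Mat d} (hS : S.PosDef) :
    Integrable (fun x => ‖x‖ ^ 2) (gaussian m S) := by
  obtain ⟨c, hc, hcoer⟩ := hS.inv.exists_mul_norm_sq_le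
  have hexp {b : ℝ} (hb : 0 < b) : Integrable fun x : Vec d => Real.exp (-b * ‖x‖ ^ 2) := by
    have := (GaussianFourier.integrable_cexp_neg_mul_sq_norm_add (V := Vec d) (b := (b : ℂ))
      (by simpa using hb) 0 0).re
    refine this.congr (Filter.Eventually.of_forall fun x => ?_)
    have : (-(b : ℂ) * (‖x‖ : ℂ) ^ 2 + 0 * (⟪(0 : Vec d), x⟫ : ℝ)) =
        ((-b * ‖x‖ ^ 2 : ℝ) : ℂ) := by push_cast; ring
    simp only [this]
    exact Complex.exp_ofReal_re _
  rw [integrable_gaussian_iff]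
  set K := Real.sqrt (((2 * π) ^ d * S.det)⁻¹)
  have hbound : Integrable fun x : Vec d =>
      K * (8 / c + 2 * ‖m‖ ^ 2) * Real.exp (-(c / 4) * ‖x - m‖ ^ 2) :=
    ((hexp (by positivity : 0 < c / 4)).comp_sub_right m).const_mul _
  refine hbound.mono' ((by fun_prop : Measurable fun x : Vec d => ‖x‖ ^ 2).mul
    (measurable_gaussianDensity m S)).aestronglyMeasurable
    (Filter.Eventually.of_forall fun x => ?_)
  rw [Real.norm_of_nonneg (mul_nonneg (by positivity) (gaussianDensity_nonneg m S x))]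
  have h₁ : ‖x‖ ^ 2 ≤ 2 * ‖x - m‖ ^ 2 + 2 * ‖m‖ ^ 2 := by
    have := norm_add_le (x - m) m
    rw [sub_add_cancel] at this
    nlinarith [norm_nonneg x, sq_nonneg (‖x - m‖ - ‖m‖)]
  set r := ‖x - m‖ ^ 2 with hr
  have hr0 : 0 ≤ r := by positivity
  have h₂ : gaussianDensity m S x ≤ K * Real.exp (-(c / 2) * r) := by
    refine mul_le_mul_of_nonneg_left (Real.exp_le_exp.2 ?_) (Real.sqrt_nonneg _)
    linarith [hcoer (x - m)]
  have h₃ : 1 + c / 4 * r ≤ Real.exp (c / 4 * r) := by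
    linarith [Real.add_one_le_exp (c / 4 * r)]
  have h₄ : 2 * r + 2 * ‖m‖ ^ 2 ≤ (8 / c + 2 * ‖m‖ ^ 2) * Real.exp (c / 4 * r) := by
    have h₅ : 2 * r ≤ 8 / c * Real.exp (c / 4 * r) := by
      calc 2 * r = 8 / c * (c / 4 * r) := by field_simp; ring
        _ ≤ _ := by gcongr; linarith
    have h₆ : 2 * ‖m‖ ^ 2 * 1 ≤ 2 * ‖m‖ ^ 2 * Real.exp (c / 4 * r) := by
      gcongr
      nlinarith
    linarith
  calc ‖x‖ ^ 2 * gaussianDensity m S x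
      ≤ ((8 / c + 2 * ‖m‖ ^ 2) * Real.exp (c / 4 * r)) * (K * Real.exp (-(c / 2) * r)) := by
        gcongr
        · exact gaussianDensity_nonneg m S x
        · linarith
    _ = K * (8 / c + 2 * ‖m‖ ^ 2) * (Real.exp (c / 4 * r) * Real.exp (-(c / 2) * r)) := by ring
    _ = _ := by rw [← Real.exp_add]; ring_nf

theorem memLp_id_gaussian (m : Vec d) {S : Mat d} (hS : S.PosDef) :
    MemLp (fun x => x) 2 (gaussian m S) :=
  (memLp_two_iff_integrable_sq_norm aestronglyMeasurable_id).2 (integrable_norm_sq_gaussian m hS)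

theorem LipschitzWith.memLp_two_gaussian {F : Type*} [NormedAddCommGroup F] {m : Vec d} {S : Mat d}
    [IsProbabilityMeasure (gaussian m S)] (hS : S.PosDef) {f : Vec d → F} {K : NNReal}
    (hf : LipschitzWith K f) : MemLp f 2 (gaussian m S) := by
  have hd : MemLp (fun x => f x - f 0) 2 (gaussian m S) := by
    refine (memLp_id_gaussian m hS).of_le_mul (c := K)
      (hf.continuous.sub continuous_const).aestronglyMeasurable
      (Filter.Eventually.of_forall fun x => ?_)
    simpa using hf.norm_sub_le x 0
  simpa [Pi.add_def] using hd.add (memLp_const (f 0))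

/-- Stein's identity for `N(m, S)`. -/
theorem integral_fderiv_matVec_gaussian {m : Vec d} {S : Mat d}
    [IsProbabilityMeasure (gaussian m S)] (hS : S.PosDef) {f : Vec d → ℝ} {K : NNReal}
    (hf : LipschitzWith K f) (hfd : Differentiable ℝ f) (v : Vec d) :
    ∫ x, fderiv ℝ f x (matVec S v) ∂(gaussian m S)
      = ∫ x, f x * ⟪v, x - m⟫ ∂(gaussian m S) := by
  have hfL := hf.memLp_two_gaussian (m := m) hS
  have hvL : MemLp (fun x => ⟪v, x - m⟫) 2 (gaussian m S) :=
    ((memLp_id_gaussian m hS).sub (memLp_const m)).const_inner v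
  have h₁ : Integrable (fun x => fderiv ℝ f x (matVec S v)) (gaussian m S) := by
    refine Integrable.of_bound (measurable_fderiv_apply_const ℝ f _).aestronglyMeasurable
      (K * ‖matVec S v‖) (Filter.Eventually.of_forall fun x => ?_)
    exact (ContinuousLinearMap.le_opNorm _ _).trans
      (by gcongr; exact norm_fderiv_le_of_lipschitz ℝ hf)
  have h₂ : Integrable (fun x => f x * ⟪v, x - m⟫) (gaussian m S) := hfL.integrable_mul hvL
  have h₃ := hfL.integrable one_le_two
  rw [integrable_gaussian_iff] at h₁ h₂ h₃
  have hρ (x : Vec d) : f x * fderiv ℝ (gaussianDensity m S) x (matVec S v)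
      = -(f x * ⟪v, x - m⟫ * gaussianDensity m S x) := by
    rw [fderiv_gaussianDensity_matVec hS]
    ring
  have key := integral_mul_fderiv_eq_neg_fderiv_mul_of_integrable (μ := volume) (v := matVec S v)
    h₁ (by simpa only [hρ] using! h₂.neg) h₃ (fun x _ => hfd x)
    (fun x _ => differentiable_gaussianDensity m S x)
  simp only [hρ, integral_neg, neg_inj] at key
  rw [integral_gaussian_eq, integral_gaussian_eq, key]

theorem integral_inner_sub_gaussian {m : Vec d} {S : Mat d}
    [IsProbabilityMeasure (gaussian m S)] (hS : S.PosDef) (v : Vec d) :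
    ∫ x, ⟪v, x - m⟫ ∂(gaussian m S) = 0 := by
  simpa using (integral_fderiv_matVec_gaussian (m := m) hS (LipschitzWith.const (1 : ℝ))
    (differentiable_const 1) v).symm

theorem fderiv_single_eq_gradient_apply (U : Vec d → ℝ) (x : Vec d) (i : Fin d) :
    fderiv ℝ U x (EuclideanSpace.single i 1) = gradient U x i := by
  rw [← inner_gradient_left, EuclideanSpace.inner_single_right]
  simp

theorem LipschitzWith.fderiv_single {U : Vec d → ℝ} {K : NNReal}
    (hlip : LipschitzWith K (gradient U)) (i : Fin d) :
    LipschitzWith K fun x => fderiv ℝ U x (EuclideanSpace.single i 1) := by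
  refine LipschitzWith.of_dist_le_mul fun x y => ?_
  refine le_trans ?_ (hlip.dist_le_mul x y)
  rw [dist_eq_norm, dist_eq_norm, fderiv_single_eq_gradient_apply,
    fderiv_single_eq_gradient_apply]
  exact PiLp.norm_apply_le (gradient U x - gradient U y) i

theorem integrable_hess {ν : Measure (Vec d)} [IsFiniteMeasure ν] {U : Vec d → ℝ} {K : NNReal}
    (hlip : LipschitzWith K (gradient U)) (i j : Fin d) :
    Integrable (fun x => hess U x i j) ν := by
  refine Integrable.of_bound (measurable_fderiv_apply_const ℝ _ _).aestronglyMeasurable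
    (K * ‖EuclideanSpace.single i (1 : ℝ)‖) (Filter.Eventually.of_forall fun x => ?_)
  exact (ContinuousLinearMap.le_opNorm _ _).trans
    (by gcongr; exact norm_fderiv_le_of_lipschitz ℝ (hlip.fderiv_single j))

theorem integrable_trace_mul_hess {ν : Measure (Vec d)} [IsFiniteMeasure ν] {U : Vec d → ℝ}
    {K : NNReal} (hlip : LipschitzWith K (gradient U)) (A : Mat d) :
    Integrable (fun x => (A * hess U x).trace) ν := by
  simp only [Matrix.trace, Matrix.diag, Matrix.mul_apply]
  exact integrable_finsetSum _ fun i _ => integrable_finsetSum _ fun j _ =>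
    (integrable_hess hlip j i).const_mul _

theorem trace_mul_intHess {ν : Measure (Vec d)} [IsFiniteMeasure ν] {U : Vec d → ℝ} {K : NNReal}
    (hlip : LipschitzWith K (gradient U)) (A : Mat d) :
    (A * intHess U ν).trace = ∫ x, (A * hess U x).trace ∂ν := by
  simp only [Matrix.trace, Matrix.diag, Matrix.mul_apply, intHess, of_apply]
  refine ((integral_finsetSum _ fun i _ => integrable_finsetSum _ fun j _ =>
    (integrable_hess hlip j i).const_mul _).trans (Finset.sum_congr rfl fun i _ => ?_)).symm
  refine (integral_finsetSum _ fun j _ => (integrable_hess hlip j i).const_mul _).trans ?_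
  simp only [integral_const_mul]

theorem integral_inner_gradient_gaussian {m : Vec d} {S : Mat d}
    [IsProbabilityMeasure (gaussian m S)] (hS : S.PosDef) {U : Vec d → ℝ} (hU : ContDiff ℝ 2 U)
    {K : NNReal} (hlip : LipschitzWith K (gradient U)) :
    ∫ x, ⟪gradient U x, x - m⟫ ∂(gaussian m S) = (S * intHess U (gaussian m S)).trace := by
  have hD : Differentiable ℝ (fderiv ℝ U) :=
    (hU.fderiv_right (m := 1) (by norm_num)).differentiable (by norm_num)
  let f (i : Fin d) (x : Vec d) : ℝ := fderiv ℝ U x (EuclideanSpace.single i 1)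
  have hf_lip (i : Fin d) : LipschitzWith K (f i) := hlip.fderiv_single i
  have hf_diff (i : Fin d) : Differentiable ℝ (f i) := hD.clm_apply (differentiable_const _)
  have hcol (i : Fin d) : matVec S (EuclideanSpace.single i 1)
      = ∑ k, S i k • EuclideanSpace.single k (1 : ℝ) := by
    ext j
    have := hS.1.apply i j
    change (S *ᵥ (EuclideanSpace.single i (1 : ℝ)).ofLp) j = _
    simp_all [Pi.single_apply]
  have hstein (i : Fin d) : ∫ x, f i x * (x - m) i ∂(gaussian m S)
      = ∑ k, S i k * ∫ x, hess U x k i ∂(gaussian m S) := by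
    have := integral_fderiv_matVec_gaussian (m := m) hS (hf_lip i) (hf_diff i)
      (EuclideanSpace.single i 1)
    simp only [EuclideanSpace.inner_single_left, map_one, one_mul] at this
    rw [← this]
    simp only [hcol, map_sum, map_smul, smul_eq_mul]
    change ∫ x, ∑ k, S i k * hess U x k i ∂(gaussian m S) = _
    rw [integral_finsetSum _ fun k _ => (integrable_hess hlip k i).const_mul _]
    simp only [integral_const_mul]
  have hcoord (i : Fin d) : Integrable (fun x => f i x * (x - m) i) (gaussian m S) := by
    have hx : MemLp (fun x => (x - m) i) 2 (gaussian m S) := by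
      simpa only [EuclideanSpace.inner_single_left, map_one, one_mul] using!
        ((memLp_id_gaussian m hS).sub (memLp_const m)).const_inner
          (𝕜 := ℝ) (EuclideanSpace.single i (1 : ℝ))
    exact ((hf_lip i).memLp_two_gaussian hS).integrable_mul hx
  have hinner (x : Vec d) : ⟪gradient U x, x - m⟫ = ∑ i, f i x * (x - m) i := by
    simp only [f, fderiv_single_eq_gradient_apply, PiLp.inner_apply]
    simp [mul_comm]
  simp only [hinner]
  rw [integral_finsetSum _ fun i _ => hcoord i]
  simp only [hstein, Matrix.trace, Matrix.diag, Matrix.mul_apply, intHess, of_apply]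

end Gaussian

section Coupling

/-- The pointwise estimate that integrates to the Hessian bound. Here `G = ∇U(x)`, `H = ∇U(y)`,
`C = ∇U(n)`, `X = x - m`, `Y = y - n`, `δ = m - n` and `D` is the Bregman divergence of `x` and
`y`. -/
theorem inner_le_of_bregman_bounds {G H C X Y δ : Vec d} {D μ L s : ℝ} (hμ : 0 < μ) (hL : 0 < L)
    (hs : 0 < s) (hsL : s ^ 2 * μ = L) (hGH : ‖G - H‖ ^ 2 ≤ 2 * L * D)
    (hXY : μ / 2 * ‖X + δ - Y‖ ^ 2 ≤ D) (hHC : ‖H - C‖ ^ 2 ≤ L * ⟪H - C, Y⟫)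
    (hY : μ * ‖Y‖ ^ 2 ≤ ⟪H - C, Y⟫) :
    ⟪G, X⟫ ≤ (2 * s + L / μ) * D + (L / s + L / 2) * (⟪δ, Y⟫ - ⟪δ, X⟫)
      + 2 / L * ⟪C, H⟫ - 2 * ⟪C, Y⟫ + 3 * ⟪H, Y⟫ := by
  have young {a : ℝ} (ha : 0 < a) (u v : Vec d) :
      ⟪u, v⟫ ≤ a / 2 * ‖u‖ ^ 2 + 1 / (2 * a) * ‖v‖ ^ 2 := by
    have h₁ := real_inner_le_norm u v
    have h₂ : a / 2 * ‖u‖ ^ 2 + 1 / (2 * a) * ‖v‖ ^ 2 - ‖u‖ * ‖v‖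
        = (a * ‖u‖ - ‖v‖) ^ 2 / (2 * a) := by
      field_simp
      ring
    have h₃ : 0 ≤ (a * ‖u‖ - ‖v‖) ^ 2 / (2 * a) := by positivity
    linarith
  have hdecomp : ⟪G, X⟫ = ⟪G - H, X - Y⟫ + ⟪H, X - Y⟫ + ⟪G - H, Y⟫ + ⟪H, Y⟫ := by
    simp only [inner_sub_left, inner_sub_right]
    ring
  have h₁ := young (a := s / L) (by positivity) (G - H) (X - Y)
  have h₂ := young (a := 2 / L) (by positivity) H (X - Y)
  have h₃ := young (a := 1 / (2 * μ)) (by positivity) (G - H) Y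
  have hΔ : ‖X - Y‖ ^ 2 ≤ 2 / μ * D + 2 * (⟪δ, Y⟫ - ⟪δ, X⟫) := by
    have e : ‖X + δ - Y‖ ^ 2 = ‖X - Y‖ ^ 2 + 2 * (⟪δ, X⟫ - ⟪δ, Y⟫) + ‖δ‖ ^ 2 := by
      rw [show X + δ - Y = (X - Y) + δ by abel, norm_add_sq_real, real_inner_comm, inner_sub_right]
    have h : ‖X + δ - Y‖ ^ 2 ≤ 2 / μ * D := by
      calc ‖X + δ - Y‖ ^ 2 = 2 / μ * (μ / 2 * ‖X + δ - Y‖ ^ 2) := by field_simp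
        _ ≤ _ := by gcongr
    nlinarith [sq_nonneg ‖δ‖]
  have hH : ‖H‖ ^ 2 ≤ L * ⟪H - C, Y⟫ + 2 * ⟪C, H⟫ := by
    have e : ‖H - C‖ ^ 2 = ‖H‖ ^ 2 - 2 * ⟪C, H⟫ + ‖C‖ ^ 2 := by
      rw [norm_sub_sq_real, real_inner_comm]
    nlinarith [sq_nonneg ‖C‖]
  have hcoef : 1 / (2 * (s / L)) + 1 / (2 * (2 / L)) = (L / s + L / 2) / 2 := by
    field_simp
  have hs' : L / (s * μ) = s := by
    rw [← hsL]
    field_simp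
  calc ⟪G, X⟫
      ≤ (s / L / 2 + 1 / (2 * μ) / 2) * ‖G - H‖ ^ 2 + (L / s + L / 2) / 2 * ‖X - Y‖ ^ 2
        + 2 / L / 2 * ‖H‖ ^ 2 + 1 / (2 * (1 / (2 * μ))) * ‖Y‖ ^ 2 + ⟪H, Y⟫ := by
        rw [← hcoef]
        linarith
    _ ≤ (s / L / 2 + 1 / (2 * μ) / 2) * (2 * L * D)
        + (L / s + L / 2) / 2 * (2 / μ * D + 2 * (⟪δ, Y⟫ - ⟪δ, X⟫))
        + 2 / L / 2 * (L * ⟪H - C, Y⟫ + 2 * ⟪C, H⟫) + ⟪H - C, Y⟫ + ⟪H, Y⟫ := by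
        have : 1 / (2 * (1 / (2 * μ))) * ‖Y‖ ^ 2 ≤ ⟪H - C, Y⟫ := by
          convert hY using 2
          field_simp
        gcongr
    _ = (s + L / (s * μ) + L / μ) * D + (L / s + L / 2) * (⟪δ, Y⟫ - ⟪δ, X⟫)
        + 2 / L * ⟪C, H⟫ - 2 * ⟪C, Y⟫ + 3 * ⟪H, Y⟫ := by
        rw [inner_sub_left]
        field_simp
        ring
    _ = _ := by
        rw [hs']
        ring

theorem integrable_inner_of_memLp_two {α : Type*} [MeasurableSpace α] {ν : Measure α}
    {f g : α → Vec d} (hf : MemLp f 2 ν) (hg : MemLp g 2 ν) :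
    Integrable (fun x => ⟪f x, g x⟫) ν :=
  memLp_one_iff_integrable.1 ((innerSL ℝ).memLp_of_bilin 1 hf hg)

theorem integral_inner_gradient_le_of_isCoupling {U : Vec d → ℝ} {μ L : ℝ} (hμ : 0 < μ)
    (hμL : μ ≤ L) (hU : ContDiff ℝ 2 U)
    (hlow : ∀ x v, μ * ‖v‖ ^ 2 ≤ fderiv ℝ (fderiv ℝ U) x v v)
    (hup : ∀ x v, fderiv ℝ (fderiv ℝ U) x v v ≤ L * ‖v‖ ^ 2)
    {m n : Vec d} {S T : Mat d} (hS : S.PosDef) (hT : T.PosDef)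
    [IsProbabilityMeasure (gaussian m S)] [IsProbabilityMeasure (gaussian n T)]
    (hgrad : intGrad U (gaussian n T) = 0) (hhess : intHess U (gaussian n T) = T⁻¹)
    {ψ : Measure (Vec d × Vec d)} (hψ : IsCoupling ψ (gaussian m S) (gaussian n T)) :
    ∫ x, ⟪gradient U x, x - m⟫ ∂(gaussian m S)
      ≤ (2 * Real.sqrt (L / μ) + L / μ) * (∫ p, bregman U p.1 p.2 ∂ψ) + 3 * d := by
  obtain ⟨hψprob, hψ₁, hψ₂⟩ := hψ
  have hL : 0 < L := hμ.trans_le hμL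
  have hpos (x v : Vec d) : 0 ≤ fderiv ℝ (fderiv ℝ U) x v v :=
    (by positivity : 0 ≤ μ * ‖v‖ ^ 2).trans (hlow x v)
  have hlip := lipschitzWith_gradient hL hU hpos hup
  have mp₁ : MeasurePreserving Prod.fst ψ (gaussian m S) := ⟨measurable_fst, hψ₁⟩
  have mp₂ : MeasurePreserving Prod.snd ψ (gaussian n T) := ⟨measurable_snd, hψ₂⟩
  have transfer₁ {f : Vec d → ℝ} (hf : Integrable f (gaussian m S)) :
      ∫ p, f p.1 ∂ψ = ∫ x, f x ∂(gaussian m S) := by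
    rw [← hψ₁, integral_map measurable_fst.aemeasurable (hψ₁ ▸ hf.aestronglyMeasurable)]
  have transfer₂ {f : Vec d → ℝ} (hf : Integrable f (gaussian n T)) :
      ∫ p, f p.2 ∂ψ = ∫ x, f x ∂(gaussian n T) := by
    rw [← hψ₂, integral_map measurable_snd.aemeasurable (hψ₂ ▸ hf.aestronglyMeasurable)]
  have hX : MemLp (fun x => x - m) 2 (gaussian m S) := (memLp_id_gaussian m hS).sub (memLp_const m)
  have hY : MemLp (fun x => x - n) 2 (gaussian n T) := (memLp_id_gaussian n hT).sub (memLp_const n)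
  have hGX : Integrable (fun x => ⟪gradient U x, x - m⟫) (gaussian m S) :=
    integrable_inner_of_memLp_two (hlip.memLp_two_gaussian hS) hX
  have hHY : Integrable (fun x => ⟪gradient U x, x - n⟫) (gaussian n T) :=
    integrable_inner_of_memLp_two (hlip.memLp_two_gaussian hT) hY
  have hvX (v : Vec d) : Integrable (fun x => ⟪v, x - m⟫) (gaussian m S) :=
    (hX.const_inner v).integrable one_le_two
  have hvY (v : Vec d) : Integrable (fun x => ⟪v, x - n⟫) (gaussian n T) :=
    (hY.const_inner v).integrable one_le_two
  have hvH (v : Vec d) : Integrable (fun x => ⟪v, gradient U x⟫) (gaussian n T) :=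
    ((hlip.memLp_two_gaussian hT).const_inner v).integrable one_le_two
  have hD : Integrable (fun p : Vec d × Vec d => bregman U p.1 p.2) ψ := by
    have hxy : MemLp (fun p : Vec d × Vec d => p.1 - p.2) 2 ψ :=
      ((memLp_id_gaussian m hS).comp_measurePreserving mp₁).sub
        ((memLp_id_gaussian n hT).comp_measurePreserving mp₂)
    have hcont : Continuous fun p : Vec d × Vec d => bregman U p.1 p.2 := by
      have h₁ := hU.continuous
      have h₂ := hlip.continuous
      unfold bregman
      fun_prop
    refine (hxy.integrable_norm_pow two_ne_zero |>.const_mul (L / 2)).mono'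
      hcont.aestronglyMeasurable (Filter.Eventually.of_forall fun p => ?_)
    rw [Real.norm_of_nonneg ((by positivity : 0 ≤ μ / 2 * ‖p.1 - p.2‖ ^ 2).trans
      (le_bregman hU hlow p.1 p.2))]
    exact bregman_le hU hup p.1 p.2
  have hHY_eq : ∫ x, ⟪gradient U x, x - n⟫ ∂(gaussian n T) = d := by
    rw [integral_inner_gradient_gaussian hT hU hlip, hhess,
      Matrix.mul_nonsing_inv T hT.det_pos.ne'.isUnit]
    simp
  have hvH_eq (v : Vec d) : ∫ x, ⟪v, gradient U x⟫ ∂(gaussian n T) = 0 := by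
    rw [integral_inner ((hlip.memLp_two_gaussian hT).integrable one_le_two)]
    rw [intGrad] at hgrad
    simp [hgrad]
  set s := Real.sqrt (L / μ) with hs_def
  have hs : 0 < s := Real.sqrt_pos.2 (by positivity)
  have hsL : s ^ 2 * μ = L := by
    rw [hs_def, Real.sq_sqrt (by positivity)]
    field_simp
  set C := gradient U n
  have ptwise (p : Vec d × Vec d) := inner_le_of_bregman_bounds (G := gradient U p.1)
    (H := gradient U p.2) (C := C) (X := p.1 - m) (Y := p.2 - n) (δ := m - n)
    (D := bregman U p.1 p.2) hμ hL hs hsL (norm_gradient_sub_sq_le_bregman hL hU hpos hup _ _)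
    (by convert le_bregman hU hlow p.1 p.2 using 4; abel)
    (norm_gradient_sub_sq_le_inner hL hU hpos hup _ _)
    (mul_norm_sub_sq_le_inner_gradient_sub hU hlow _ _)
  have i₁ := mp₁.integrable_comp_of_integrable hGX
  have i₂ := mp₂.integrable_comp_of_integrable (hvY (m - n))
  have i₃ := mp₁.integrable_comp_of_integrable (hvX (m - n))
  have i₄ := mp₂.integrable_comp_of_integrable (hvH C)
  have i₅ := mp₂.integrable_comp_of_integrable (hvY C)
  have i₆ := mp₂.integrable_comp_of_integrable hHY
  have j₁ := hD.const_mul (2 * s + L / μ)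
  have j₂ := (i₂.sub i₃).const_mul (L / s + L / 2)
  have j₄ := i₄.const_mul (2 / L)
  have j₅ := i₅.const_mul 2
  have j₆ := i₆.const_mul 3
  have hint := integral_mono i₁ ((((j₁.add j₂).add j₄).sub j₅).add j₆) ptwise
  rw [integral_add' (((j₁.add j₂).add j₄).sub j₅) j₆, integral_sub' ((j₁.add j₂).add j₄) j₅,
    integral_add' (j₁.add j₂) j₄, integral_add' j₁ j₂] at hint
  simp only [integral_const_mul] at hint
  rw [integral_sub' i₂ i₃] at hint
  simp only [Function.comp_def] at hint
  rw [transfer₁ hGX, transfer₂ (hvY (m - n)), transfer₁ (hvX (m - n)), transfer₂ (hvH C),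
    transfer₂ (hvY C), transfer₂ hHY, hHY_eq, hvH_eq, integral_inner_sub_gaussian hS,
    integral_inner_sub_gaussian hT, integral_inner_sub_gaussian hT] at hint
  linarith

end Coupling

/-- **Bound on the covariance-weighted Hessian norm** (Lemma C.2).
With `κ = L/μ`, stationarity of `q_* = N(m_*,Σ_*)`, and any coupling `ψ` of
`q = N(m,Σ)` and `q_*`:
`∫ tr(∇²U(z) Σ ∇²U(z)) dq(z) ≤ L(2√κ + κ)·∫ D_U dψ + 3dL`. -/
theorem covariance_weighted_hessian_bound
    (d : ℕ) (hd : 0 < d) (U : Vec d → ℝ) (μ L : ℝ) (hμ : 0 < μ) (hμL : μ ≤ L)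
    (hU : ContDiff ℝ 2 U)
    (hconv : ∀ x : Vec d,
      (hess U x - μ • 1).PosSemidef ∧ ((L • (1 : Mat d)) - hess U x).PosSemidef)
    (m : Vec d) (S : Mat d) (hS : S.PosDef)
    (mstar : Vec d) (Sstar : Mat d) (hSstar : Sstar.PosDef)
    (hstat1 : intGrad U (gaussian mstar Sstar) = 0)
    (hstat2 : intHess U (gaussian mstar Sstar) = Sstar⁻¹)
    (ψ : Measure (Vec d × Vec d))
    (hψ : IsCoupling ψ (gaussian m S) (gaussian mstar Sstar)) :
    (∫ z, (hess U z * S * hess U z).trace ∂(gaussian m S))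
      ≤ L * (2 * Real.sqrt (L / μ) + L / μ) * (∫ p, bregman U p.1 p.2 ∂ψ)
        + 3 * d * L := by
  have hL : 0 < L := hμ.trans_le hμL
  obtain ⟨hψprob, hψ₁, hψ₂⟩ := id hψ
  have : IsProbabilityMeasure (gaussian m S) :=
    hψ₁ ▸ Measure.isProbabilityMeasure_map measurable_fst.aemeasurable
  have : IsProbabilityMeasure (gaussian mstar Sstar) :=
    hψ₂ ▸ Measure.isProbabilityMeasure_map measurable_snd.aemeasurable
  have hlow (x v : Vec d) : μ * ‖v‖ ^ 2 ≤ fderiv ℝ (fderiv ℝ U) x v v := by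
    have := (hconv x).1.inner_matVec_nonneg v
    rw [inner_matVec_sub, inner_matVec_smul_one, inner_matVec_hess hU] at this
    linarith
  have hup (x v : Vec d) : fderiv ℝ (fderiv ℝ U) x v v ≤ L * ‖v‖ ^ 2 := by
    have := (hconv x).2.inner_matVec_nonneg v
    rw [inner_matVec_sub, inner_matVec_smul_one, inner_matVec_hess hU] at this
    linarith
  have hpsd (x : Vec d) : (hess U x).PosSemidef := by
    simpa using (hconv x).1.add (Matrix.PosSemidef.one.smul hμ.le)
  have hlip := lipschitzWith_gradient hL hU
    (fun x v => (by positivity : 0 ≤ μ * ‖v‖ ^ 2).trans (hlow x v)) hup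
  have hcoupled := integral_inner_gradient_le_of_isCoupling hμ hμL hU hlow hup hS hSstar
    hstat1 hstat2 hψ
  rw [integral_inner_gradient_gaussian hS hU hlip,
    trace_mul_intHess hlip] at hcoupled
  calc ∫ z, (hess U z * S * hess U z).trace ∂(gaussian m S)
      ≤ ∫ z, L * (S * hess U z).trace ∂(gaussian m S) := by
        refine integral_mono_of_nonneg (Filter.Eventually.of_forall fun z => ?_)
          ((integrable_trace_mul_hess hlip S).const_mul L)
          (Filter.Eventually.of_forall fun z =>
            trace_mul_mul_self_le hL (hpsd z) (hconv z).2 hS.posSemidef)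
        have := hS.posSemidef.mul_mul_conjTranspose_same (hess U z)
        rw [(hpsd z).1.eq] at this
        exact this.trace_nonneg
    _ = L * ∫ z, (S * hess U z).trace ∂(gaussian m S) := integral_const_mul _ _
    _ ≤ L * ((2 * Real.sqrt (L / μ) + L / μ) * (∫ p, bregman U p.1 p.2 ∂ψ) + 3 * d) := by
        gcongr
    _ = _ := by ring
end
end
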